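/- arXiv:math/0010312 — 3 statements merged into one kernel-verified Lean document; each statement's English description precedes it below -/
import Mathlib

section
/- Let α, β ∈ ℂ with α + β = 1, and in M₃(ℂ) set H = α e_{1,1} − β e_{3,3}, A = e_{1,2}, B = e_{2,3}, E = e_{1,3}. Then the extended jordanian classical r-matrix r = H⊗E − E⊗H + A⊗B − B⊗A satisfies the classical Yang–Baxter equation in M₃(ℂ)⊗M₃(ℂ)⊗M₃(ℂ). -/
/-- Matrix units `e_{a,b}` of `M₃(ℂ)`, with 1-based indices `1 ≤ a, b ≤ 3`. -/
noncomputable def e3 (a b : ℕ) : Matrix (Fin 3) (Fin 3) ℂ :=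
  Matrix.of fun p q => if p.val + 1 = a ∧ q.val + 1 = b then 1 else 0

open TensorProduct

/-- `r₁₂ : x ⊗ y ↦ (x ⊗ y) ⊗ 1`. -/
noncomputable def emb12 (A : Type) [Ring A] [Algebra ℂ A] :
    (A ⊗[ℂ] A) →ₐ[ℂ] (A ⊗[ℂ] A) ⊗[ℂ] A :=
  Algebra.TensorProduct.includeLeft

/-- `r₁₃ : x ⊗ y ↦ (x ⊗ 1) ⊗ y`. -/
noncomputable def emb13 (A : Type) [Ring A] [Algebra ℂ A] :
    (A ⊗[ℂ] A) →ₐ[ℂ] (A ⊗[ℂ] A) ⊗[ℂ] A :=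
  Algebra.TensorProduct.map Algebra.TensorProduct.includeLeft (AlgHom.id ℂ A)

/-- `r₂₃ : x ⊗ y ↦ (1 ⊗ x) ⊗ y`. -/
noncomputable def emb23 (A : Type) [Ring A] [Algebra ℂ A] :
    (A ⊗[ℂ] A) →ₐ[ℂ] (A ⊗[ℂ] A) ⊗[ℂ] A :=
  Algebra.TensorProduct.map Algebra.TensorProduct.includeRight (AlgHom.id ℂ A)

/-- The classical Yang–Baxter equation `[r₁₂,r₁₃] + [r₁₂,r₂₃] + [r₁₃,r₂₃] = 0`,
with the commutator bracket `[X,Y] = XY − YX`. -/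
def CYBE (A : Type) [Ring A] [Algebra ℂ A] (r : A ⊗[ℂ] A) : Prop :=
  (emb12 A r * emb13 A r - emb13 A r * emb12 A r) +
  (emb12 A r * emb23 A r - emb23 A r * emb12 A r) +
  (emb13 A r * emb23 A r - emb23 A r * emb13 A r) = 0

/-- `x ∧ y := x ⊗ y − y ⊗ x`. -/
noncomputable def wedge {A : Type} [Ring A] [Algebra ℂ A] (x y : A) : A ⊗[ℂ] A :=
  x ⊗ₜ[ℂ] y - y ⊗ₜ[ℂ] x

/-- In any algebra, `H ∧ E + A ∧ B` solves the classical Yang–Baxter equation as soon as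
`[H, E] = E`, `[H, A] = α A`, `[H, B] = (1 - α) B`, `[A, B] = E` and `E` commutes with `A`
and `B`. -/
theorem CYBE_of_extended_jordanian_relations {R : Type} [Ring R] [Algebra ℂ R] {α : ℂ}
    {H A B E : R} (hHE : H * E = E * H + E) (hHA : H * A = A * H + α • A)
    (hHB : H * B = B * H + (1 - α) • B) (hAB : A * B = B * A + E)
    (hAE : A * E = E * A) (hBE : B * E = E * B) :
    CYBE R (H ⊗ₜ[ℂ] E - E ⊗ₜ[ℂ] H + A ⊗ₜ[ℂ] B - B ⊗ₜ[ℂ] A) := by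
  simp only [CYBE, emb12, emb13, emb23, map_add, map_sub,
    Algebra.TensorProduct.includeLeft_apply, Algebra.TensorProduct.map_tmul,
    Algebra.TensorProduct.includeRight_apply, AlgHom.id_apply,
    mul_add, add_mul, mul_sub, sub_mul, Algebra.TensorProduct.tmul_mul_tmul,
    one_mul, mul_one, hHE, hHA, hHB, hAB, hAE, hBE,
    TensorProduct.tmul_add, TensorProduct.add_tmul, TensorProduct.tmul_smul,
    ← TensorProduct.smul_tmul']
  module

/-- the extended jordanian classical r-matrix
`r = H⊗E − E⊗H + A⊗B − B⊗A` (with `H = α e₁₁ − β e₃₃`, `A = e₁₂`, `B = e₂₃`, `E = e₁₃`,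
`α + β = 1`) satisfies the classical Yang–Baxter equation in `M₃(ℂ)⊗M₃(ℂ)⊗M₃(ℂ)`. -/
theorem extended_jordanian_r_matrix_CYBE (α β : ℂ) (hαβ : α + β = 1)
    (H A B E : Matrix (Fin 3) (Fin 3) ℂ)
    (hH : H = α • e3 1 1 - β • e3 3 3) (hA : A = e3 1 2) (hB : B = e3 2 3)
    (hE : E = e3 1 3) :
    CYBE (Matrix (Fin 3) (Fin 3) ℂ)
      (H ⊗ₜ[ℂ] E - E ⊗ₜ[ℂ] H + A ⊗ₜ[ℂ] B - B ⊗ₜ[ℂ] A) := by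
  have hβ : β = 1 - α := by linear_combination hαβ
  subst hH hA hB hE hβ
  apply CYBE_of_extended_jordanian_relations (α := α) <;>
    ext i j <;> fin_cases i <;> fin_cases j <;>
    simp [e3, Matrix.mul_apply, Fin.sum_univ_three]
end

section
/- Let N ≥ 2. The classical r-matrix of the full extended jordanian twist of sp(N,ℂ), r = H₁₁ ∧ E_{1+1} + Σ_{i=2}^{N} E_{1−i} ∧ E_{1+i}, satisfies the classical Yang–Baxter equation in M_{2N}(ℂ)⊗M_{2N}(ℂ)⊗M_{2N}(ℂ). -/
/- Matrix units `e_{a,b}` of `M_{2N}(ℂ)`, with 1-based indices `1 ≤ a, b ≤ 2N`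
   (out-of-range indices give the zero matrix). -/
noncomputable def eM (N a b : ℕ) : Matrix (Fin (2*N)) (Fin (2*N)) ℂ :=
  Matrix.of fun p q => if p.val + 1 = a ∧ q.val + 1 = b then 1 else 0

/-- `H_{kk} = (1/2)(e_{k,k} - e_{N+k,N+k})`, `1 ≤ k ≤ N`. -/
noncomputable def Hgen (N k : ℕ) : Matrix (Fin (2*N)) (Fin (2*N)) ℂ :=
  (1/2 : ℂ) • (eM N k k - eM N (N+k) (N+k))

/-- `E_{k+i} = e_{k,N+i} + e_{i,N+k}` (so `E_{k+k} = 2 e_{k,N+k}`), `1 ≤ k ≤ i ≤ N`. -/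
noncomputable def Ep (N k i : ℕ) : Matrix (Fin (2*N)) (Fin (2*N)) ℂ :=
  eM N k (N+i) + eM N i (N+k)

/-- `E_{k−i} = e_{k,i} - e_{N+i,N+k}`, `1 ≤ k < i ≤ N`. -/
noncomputable def Em (N k i : ℕ) : Matrix (Fin (2*N)) (Fin (2*N)) ℂ :=
  eM N k i - eM N (N+i) (N+k)

open TensorProduct

section

attribute [local instance] LieRing.ofAssociativeRing

/-- The classical Yang–Baxter expression `[r₁₂,s₁₃] + [r₁₂,s₂₃] + [r₁₃,s₂₃]` as a bilinear map. -/
noncomputable def yangBaxterForm (A : Type) [Ring A] [Algebra ℂ A] :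
    (A ⊗[ℂ] A) →ₗ[ℂ] (A ⊗[ℂ] A) →ₗ[ℂ] (A ⊗[ℂ] A) ⊗[ℂ] A :=
  LinearMap.mk₂ ℂ
    (fun r s => ⁅emb12 A r, emb13 A s⁆ + ⁅emb12 A r, emb23 A s⁆ + ⁅emb13 A r, emb23 A s⁆)
    (fun r r' s => by simp only [map_add, add_lie]; abel)
    (fun c r s => by
      simp only [map_smul, Ring.lie_def, smul_mul_assoc, mul_smul_comm, smul_add, smul_sub])
    (fun r s s' => by simp only [map_add, lie_add]; abel)
    (fun c r s => by
      simp only [map_smul, Ring.lie_def, smul_mul_assoc, mul_smul_comm, smul_add, smul_sub])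

theorem CYBE_iff_yangBaxterForm {A : Type} [Ring A] [Algebra ℂ A] (r : A ⊗[ℂ] A) :
    CYBE A r ↔ yangBaxterForm A r r = 0 :=
  Iff.rfl

theorem yangBaxterForm_tmul {A : Type} [Ring A] [Algebra ℂ A] (a b c d : A) :
    yangBaxterForm A (a ⊗ₜ b) (c ⊗ₜ d) =
      (⁅a, c⁆ ⊗ₜ b) ⊗ₜ d + (a ⊗ₜ ⁅b, c⁆) ⊗ₜ d + (a ⊗ₜ c) ⊗ₜ ⁅b, d⁆ := by
  simp [yangBaxterForm, emb12, emb13, emb23, Ring.lie_def, TensorProduct.sub_tmul,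
    TensorProduct.tmul_sub]

theorem yangBaxterForm_wedge {A : Type} [Ring A] [Algebra ℂ A] (a b c d : A) :
    yangBaxterForm A (wedge a b) (wedge c d) =
      yangBaxterForm A (a ⊗ₜ b) (c ⊗ₜ d) - yangBaxterForm A (a ⊗ₜ b) (d ⊗ₜ c)
        - (yangBaxterForm A (b ⊗ₜ a) (c ⊗ₜ d) - yangBaxterForm A (b ⊗ₜ a) (d ⊗ₜ c)) := by
  simp only [wedge, map_sub, LinearMap.sub_apply]
  abel

/-- Extended jordanian r-matrices satisfy the classical Yang–Baxter equation. -/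
theorem CYBE_extended_jordanian {A ι : Type} [Ring A] [Algebra ℂ A] (s : Finset ι)
    (H E : A) (X Y : ι → A) (hHE : ⁅H, E⁆ = E)
    (hHX : ∀ i ∈ s, ⁅H, X i⁆ = (1 / 2 : ℂ) • X i)
    (hHY : ∀ i ∈ s, ⁅H, Y i⁆ = (1 / 2 : ℂ) • Y i)
    (hEX : ∀ i ∈ s, ⁅E, X i⁆ = 0) (hEY : ∀ i ∈ s, ⁅E, Y i⁆ = 0)
    (hXX : ∀ i ∈ s, ∀ j ∈ s, ⁅X i, X j⁆ = 0) (hYY : ∀ i ∈ s, ∀ j ∈ s, ⁅Y i, Y j⁆ = 0)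
    (hXY : ∀ i ∈ s, ⁅X i, Y i⁆ = E)
    (hXY_ne : ∀ i ∈ s, ∀ j ∈ s, i ≠ j → ⁅X i, Y j⁆ = 0) :
    CYBE A (wedge H E + ∑ i ∈ s, wedge (X i) (Y i)) := by
  have skew {a b c : A} (h : ⁅a, b⁆ = c) : ⁅b, a⁆ = -c := by rw [← h, lie_skew]
  have off_diagonal : ∀ i ∈ s, ∀ j ∈ s, j ≠ i →
      yangBaxterForm A (wedge (X i) (Y i)) (wedge (X j) (Y j)) = 0 := by
    intro i hi j hj hne
    simp [yangBaxterForm_wedge, yangBaxterForm_tmul, hXX i hi j hj, hYY i hi j hj,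
      hXY_ne i hi j hj hne.symm, skew (hXY_ne j hj i hi hne)]
  have jordanian : yangBaxterForm A (wedge H E) (wedge H E) = 0 := by
    simp only [yangBaxterForm_wedge, yangBaxterForm_tmul, hHE, skew hHE, lie_self,
      TensorProduct.zero_tmul, TensorProduct.tmul_zero, TensorProduct.neg_tmul,
      TensorProduct.tmul_neg]
    abel
  have extension : ∀ i ∈ s,
      yangBaxterForm A (wedge H E) (wedge (X i) (Y i)) +
        yangBaxterForm A (wedge (X i) (Y i)) (wedge H E) +
        yangBaxterForm A (wedge (X i) (Y i)) (wedge (X i) (Y i)) = 0 := by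
    intro i hi
    simp only [yangBaxterForm_wedge, yangBaxterForm_tmul, hHX i hi, skew (hHX i hi), hHY i hi,
      skew (hHY i hi), hEX i hi, skew (hEX i hi), hEY i hi, skew (hEY i hi), hXY i hi,
      skew (hXY i hi), lie_self, neg_zero, TensorProduct.zero_tmul, TensorProduct.tmul_zero,
      TensorProduct.neg_tmul, TensorProduct.tmul_neg, TensorProduct.tmul_smul,
      ← TensorProduct.smul_tmul']
    module
  rw [CYBE_iff_yangBaxterForm]
  have diagonal : ∑ j ∈ s, ∑ i ∈ s, yangBaxterForm A (wedge (X i) (Y i)) (wedge (X j) (Y j)) =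
      ∑ i ∈ s, yangBaxterForm A (wedge (X i) (Y i)) (wedge (X i) (Y i)) :=
    Finset.sum_congr rfl fun j hj => Finset.sum_eq_single_of_mem j hj
      fun i hi hne => off_diagonal i hi j hj hne.symm
  simp only [map_add, map_sum, LinearMap.add_apply, LinearMap.sum_apply, jordanian, zero_add,
    Finset.sum_add_distrib, diagonal]
  simp only [← Finset.sum_add_distrib]
  refine Finset.sum_eq_zero fun i hi => ?_
  rw [← extension i hi]
  abel

end

theorem eM_mul_of_ne (N a d : ℕ) {b c : ℕ} (h : b ≠ c) : eM N a b * eM N c d = 0 := by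
  ext p q
  rw [Matrix.mul_apply]
  refine Finset.sum_eq_zero fun k _ => ?_
  simp only [eM, Matrix.of_apply]
  grind

theorem eM_mul_eM (N a d : ℕ) {b : ℕ} (h₁ : 1 ≤ b) (h₂ : b ≤ 2 * N) :
    eM N a b * eM N b d = eM N a d := by
  ext p q
  rw [Matrix.mul_apply, Finset.sum_eq_single (⟨b - 1, by omega⟩ : Fin (2 * N))]
  · simp only [eM, Matrix.of_apply]
    grind
  · intro k _ hk
    simp only [eM, Matrix.of_apply]
    have : k.val + 1 ≠ b := fun h => hk (Fin.ext (by simp; omega))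
    grind
  · simp

/-- the classical r-matrix of the full extended jordanian twist of `sp(N,ℂ)`,
`r = H₁₁ ∧ E_{1+1} + Σ_{i=2}^{N} E_{1−i} ∧ E_{1+i}`, satisfies the classical
Yang–Baxter equation. -/
theorem full_extended_twist_r_matrix_CYBE (N : ℕ) (hN : 2 ≤ N) :
    CYBE (Matrix (Fin (2*N)) (Fin (2*N)) ℂ)
      (wedge (Hgen N 1) (Ep N 1 1) +
        ∑ i ∈ Finset.Icc 2 N, wedge (Em N 1 i) (Ep N 1 i)) := by
  apply CYBE_extended_jordanian
  all_goals
    intros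
    try simp only [Finset.mem_Icc] at *
    simp (disch := omega) only [Ring.lie_def, Hgen, Ep, Em, mul_add, add_mul, mul_sub, sub_mul,
      smul_mul_assoc, mul_smul_comm, eM_mul_eM, eM_mul_of_ne]
    try module
end

section
/- Let N ≥ 1, let η₁,…,η_N ∈ ℂ, and let κ₁,…,κ_N ∈ {0,1}. Then the multiparametric chain classical r-matrix r = Σ_{k=1}^{N} η_k ( H_{kk} ∧ E_{k+k} + κ_k Σ_{i=k+1}^{N} E_{k−i} ∧ E_{k+i} ) satisfies the classical Yang–Baxter equation in M_{2N}(ℂ)⊗M_{2N}(ℂ)⊗M_{2N}(ℂ). -/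
open TensorProduct

section YangBaxter

variable {A : Type} [Ring A] [Algebra ℂ A]

/-- The bilinear form `(s, t) ↦ [s₁₂,t₁₃] + [s₁₂,t₂₃] + [s₁₃,t₂₃]` whose diagonal is the
left-hand side of the classical Yang–Baxter equation. -/
noncomputable def cybeForm : (A ⊗[ℂ] A) →ₗ[ℂ] (A ⊗[ℂ] A) →ₗ[ℂ] (A ⊗[ℂ] A) ⊗[ℂ] A :=
  LinearMap.mk₂ ℂ
    (fun s t =>
      (emb12 A s * emb13 A t - emb13 A t * emb12 A s) +
      (emb12 A s * emb23 A t - emb23 A t * emb12 A s) +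
      (emb13 A s * emb23 A t - emb23 A t * emb13 A s))
    (fun s s' t => by simp only [map_add, add_mul, mul_add]; abel)
    (fun c s t => by
      simp only [map_smul, smul_mul_assoc, mul_smul_comm, smul_add, smul_sub])
    (fun s t t' => by simp only [map_add, add_mul, mul_add]; abel)
    (fun c s t => by
      simp only [map_smul, smul_mul_assoc, mul_smul_comm, smul_add, smul_sub])

theorem neg_commutator {R : Type*} [Ring R] (x y : R) : -⁅y, x⁆ = ⁅x, y⁆ := by
  simp [Ring.lie_def]

theorem commutator_smul (c : ℂ) (x y : A) : ⁅x, c • y⁆ = c • ⁅x, y⁆ := by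
  simp [Ring.lie_def, smul_sub]

theorem smul_commutator (c : ℂ) (x y : A) : ⁅c • x, y⁆ = c • ⁅x, y⁆ := by
  simp [Ring.lie_def, smul_sub]

theorem cybe_iff_cybeForm (r : A ⊗[ℂ] A) : CYBE A r ↔ cybeForm r r = 0 := Iff.rfl

theorem cybeForm_tmul (a b c d : A) :
    cybeForm (a ⊗ₜ[ℂ] b) (c ⊗ₜ[ℂ] d) =
      (⁅a, c⁆ ⊗ₜ[ℂ] b) ⊗ₜ[ℂ] d + (a ⊗ₜ[ℂ] ⁅b, c⁆) ⊗ₜ[ℂ] d + (a ⊗ₜ[ℂ] c) ⊗ₜ[ℂ] ⁅b, d⁆ := by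
  simp [cybeForm, emb12, emb13, emb23, Ring.lie_def, sub_tmul, tmul_sub]

/-- Polarized form of the Yang–Baxter equation for a finite sum. -/
theorem cybeForm_sum_self {ι : Type*} (S : Finset ι) (f : ι → A ⊗[ℂ] A)
    (h : ∀ i ∈ S, ∀ j ∈ S, cybeForm (f i) (f j) + cybeForm (f j) (f i) = 0) :
    cybeForm (∑ i ∈ S, f i) (∑ i ∈ S, f i) = 0 := by
  have hdouble : cybeForm (∑ i ∈ S, f i) (∑ i ∈ S, f i) +
      cybeForm (∑ i ∈ S, f i) (∑ i ∈ S, f i) = 0 := by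
    have e : cybeForm (∑ i ∈ S, f i) (∑ i ∈ S, f i) =
        ∑ i ∈ S, ∑ j ∈ S, cybeForm (f i) (f j) := by
      simp only [map_sum, LinearMap.sum_apply]
      exact Finset.sum_comm
    conv_lhs => rw [e]; arg 2; rw [Finset.sum_comm]
    simp only [← Finset.sum_add_distrib]
    exact Finset.sum_eq_zero fun i hi => Finset.sum_eq_zero fun j hj => h i hi j hj
  rw [← two_smul ℂ] at hdouble
  exact (smul_eq_zero.mp hdouble).resolve_left two_ne_zero

/-- The adjoint action of `x` on `A ⊗ A`, as the commutator with `x ⊗ 1 + 1 ⊗ x`. -/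
noncomputable def adTensor (x : A) : (A ⊗[ℂ] A) →ₗ[ℂ] A ⊗[ℂ] A :=
  LinearMap.mulLeft ℂ (x ⊗ₜ[ℂ] 1 + 1 ⊗ₜ[ℂ] x) - LinearMap.mulRight ℂ (x ⊗ₜ[ℂ] 1 + 1 ⊗ₜ[ℂ] x)

theorem adTensor_tmul (x a b : A) :
    adTensor x (a ⊗ₜ[ℂ] b) = ⁅x, a⁆ ⊗ₜ[ℂ] b + a ⊗ₜ[ℂ] ⁅x, b⁆ := by
  simp [adTensor, Ring.lie_def, sub_tmul, tmul_sub, add_mul, mul_add]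
  abel

theorem adTensor_wedge (x a b : A) :
    adTensor x (wedge a b) = wedge ⁅x, a⁆ b + wedge a ⁅x, b⁆ := by
  simp only [wedge, map_sub, adTensor_tmul]
  abel

theorem adTensor_smul_left (c : ℂ) (x : A) (s : A ⊗[ℂ] A) :
    adTensor (c • x) s = c • adTensor x s := by
  simp only [adTensor, ← smul_tmul', tmul_smul, ← smul_add, LinearMap.sub_apply,
    LinearMap.mulLeft_apply, LinearMap.mulRight_apply, smul_mul_assoc, mul_smul_comm, smul_sub]

theorem cybeForm_wedge_add (s : A ⊗[ℂ] A) (x y : A) :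
    cybeForm s (wedge x y) + cybeForm (wedge x y) s =
      emb12 A (adTensor y s) * (1 ⊗ₜ[ℂ] x) - emb12 A (adTensor x s) * (1 ⊗ₜ[ℂ] y) +
      ((x ⊗ₜ[ℂ] 1) ⊗ₜ[ℂ] 1 * emb23 A (adTensor y s) -
        (y ⊗ₜ[ℂ] 1) ⊗ₜ[ℂ] 1 * emb23 A (adTensor x s)) +
      ((1 ⊗ₜ[ℂ] y) ⊗ₜ[ℂ] 1 * emb13 A (adTensor x s) -
        (1 ⊗ₜ[ℂ] x) ⊗ₜ[ℂ] 1 * emb13 A (adTensor y s)) := by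
  induction s using TensorProduct.induction_on with
  | zero => simp
  | add s t hs ht =>
    simp only [map_add, LinearMap.add_apply, add_mul, mul_add] at hs ht ⊢
    rw [add_add_add_comm, hs, ht]
    abel
  | tmul a b =>
    simp only [wedge, map_sub, LinearMap.sub_apply, cybeForm_tmul, adTensor_tmul, emb12, emb13,
      emb23, Ring.lie_def, sub_tmul, tmul_sub, map_add, Algebra.TensorProduct.map_tmul,
      Algebra.TensorProduct.includeLeft_apply, Algebra.TensorProduct.includeRight_apply,
      Algebra.TensorProduct.tmul_mul_tmul, AlgHom.coe_id, id, mul_one, one_mul, add_mul, mul_add,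
      sub_mul, mul_sub]
    abel

theorem cybeForm_wedge_eq_zero {s : A ⊗[ℂ] A} {x y : A} (hx : adTensor x s = 0)
    (hy : adTensor y s = 0) : cybeForm s (wedge x y) + cybeForm (wedge x y) s = 0 := by
  rw [cybeForm_wedge_add, hx, hy]
  simp

/-- The Jordanian `r`-matrix of `[h, e] = e`. -/
theorem cybeForm_jordanian {h e : A} (he : ⁅h, e⁆ = e) :
    cybeForm (wedge h e) (wedge h e) = 0 := by
  have eh : ⁅e, h⁆ = -e := by rw [← neg_commutator, he]
  simp only [wedge, map_sub, LinearMap.sub_apply, cybeForm_tmul, he, eh, Ring.lie_def, sub_self,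
    tmul_zero, zero_tmul, neg_tmul, tmul_neg]
  abel

/-- Extended Jordanian `r`-matrices: `a i`, `b i` span a Heisenberg algebra with centre `e`, on
which `h` acts with weight `1/2`. -/
theorem cybeForm_extended_jordanian {ι : Type*} (S : Finset ι) {h e : A} {a b : ι → A} {κ : ℂ}
    (hκ : κ = 0 ∨ κ = 1) (he : ⁅h, e⁆ = e)
    (ha : ∀ i ∈ S, ⁅h, a i⁆ = (1 / 2 : ℂ) • a i) (hb : ∀ i ∈ S, ⁅h, b i⁆ = (1 / 2 : ℂ) • b i)
    (ea : ∀ i ∈ S, ⁅e, a i⁆ = 0) (eb : ∀ i ∈ S, ⁅e, b i⁆ = 0)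
    (aa : ∀ i ∈ S, ∀ j ∈ S, ⁅a i, a j⁆ = 0) (bb : ∀ i ∈ S, ∀ j ∈ S, ⁅b i, b j⁆ = 0)
    (ab : ∀ i ∈ S, ⁅a i, b i⁆ = e) (ab' : ∀ i ∈ S, ∀ j ∈ S, i ≠ j → ⁅a i, b j⁆ = 0) :
    cybeForm (wedge h e + κ • ∑ i ∈ S, wedge (a i) (b i))
      (wedge h e + κ • ∑ i ∈ S, wedge (a i) (b i)) = 0 := by
  rcases hκ with rfl | rfl
  · simpa using cybeForm_jordanian he
  have hcross : ∀ i ∈ S, ∀ j ∈ S, i ≠ j →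
      cybeForm (wedge (a i) (b i)) (wedge (a j) (b j)) = 0 := by
    intro i hi j hj hij
    have ba : ⁅b i, a j⁆ = 0 := by rw [← neg_commutator, ab' j hj i hi hij.symm, neg_zero]
    simp only [wedge, map_sub, LinearMap.sub_apply, cybeForm_tmul, aa i hi j hj, bb i hi j hj,
      ab' i hi j hj hij, ba, tmul_zero, zero_tmul, add_zero, sub_self]
  have hdiag : ∀ i ∈ S, cybeForm (wedge h e) (wedge (a i) (b i)) +
      cybeForm (wedge (a i) (b i)) (wedge h e) +
      cybeForm (wedge (a i) (b i)) (wedge (a i) (b i)) = 0 := by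
    intro i hi
    have ah : ⁅a i, h⁆ = -((1 / 2 : ℂ) • a i) := by rw [← neg_commutator, ha i hi]
    have bh : ⁅b i, h⁆ = -((1 / 2 : ℂ) • b i) := by rw [← neg_commutator, hb i hi]
    have ae : ⁅a i, e⁆ = 0 := by rw [← neg_commutator, ea i hi, neg_zero]
    have be : ⁅b i, e⁆ = 0 := by rw [← neg_commutator, eb i hi, neg_zero]
    have ba : ⁅b i, a i⁆ = -e := by rw [← neg_commutator, ab i hi]
    simp only [wedge, map_sub, LinearMap.sub_apply, cybeForm_tmul, ha i hi, hb i hi, ea i hi,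
      eb i hi, aa i hi i hi, bb i hi i hi, ab i hi, ah, bh, ae, be, ba, tmul_zero, zero_tmul,
      neg_tmul, tmul_neg, tmul_smul, ← smul_tmul']
    module
  have hsum : cybeForm (∑ i ∈ S, wedge (a i) (b i)) (∑ i ∈ S, wedge (a i) (b i)) =
      ∑ i ∈ S, cybeForm (wedge (a i) (b i)) (wedge (a i) (b i)) := by
    simp only [map_sum, LinearMap.sum_apply]
    refine Finset.sum_congr rfl fun i hi => ?_
    exact Finset.sum_eq_single i (fun j hj hji => hcross j hj i hi hji) fun hn => absurd hi hn
  have hzero := Finset.sum_eq_zero hdiag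
  simp only [Finset.sum_add_distrib] at hzero
  simp only [one_smul, map_add, LinearMap.add_apply, cybeForm_jordanian he, hsum, zero_add]
  simp only [map_sum, LinearMap.sum_apply]
  rw [← hzero]
  abel

end YangBaxter

section Symplectic

variable {N : ℕ}

theorem eM_mul {b : ℕ} (hb : 1 ≤ b) (hb' : b ≤ 2 * N) (a c d : ℕ) :
    eM N a b * eM N c d = if b = c then eM N a d else 0 := by
  ext p q
  obtain ⟨m, rfl⟩ : ∃ m, b = m + 1 := ⟨b - 1, by omega⟩
  rw [Matrix.mul_apply, Finset.sum_eq_single (⟨m, hb'⟩ : Fin (2 * N))]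
  · split_ifs with h
    · by_cases hp : p.val + 1 = a <;> simp [eM, hp, h]
    · simp [eM, h]
  · intro x _ hx
    have : x.val ≠ m := fun h => hx (Fin.ext h)
    simp [eM, this]
  · simp

theorem Hgen_eq_smul_Em (k : ℕ) : Hgen N k = (1 / 2 : ℂ) • Em N k k := rfl

theorem Ep_comm (p q : ℕ) : Ep N p q = Ep N q p := add_comm _ _

theorem lie_Em_Em {p q k j : ℕ} (hp : p ∈ Finset.Icc 1 N) (hq : q ∈ Finset.Icc 1 N)
    (hk : k ∈ Finset.Icc 1 N) (hj : j ∈ Finset.Icc 1 N) :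
    ⁅Em N p q, Em N k j⁆ =
      (if q = k then Em N p j else 0) - (if j = p then Em N k q else 0) := by
  rw [Finset.mem_Icc] at hp hq hk hj
  have hne : ∀ x, x ≤ N → ∀ y, 1 ≤ y → x ≠ N + y := by omega
  have hne' : ∀ x, x ≤ N → ∀ y, 1 ≤ y → N + y ≠ x := by omega
  simp (disch := omega) only [Ring.lie_def, Em, sub_mul, mul_sub, eM_mul, Nat.add_left_cancel_iff]
  simp (disch := omega) only [hne, hne', if_false]
  simp only [eq_comm (a := p), eq_comm (a := k)]
  split_ifs <;> abel

theorem lie_Em_Ep {p q k j : ℕ} (hp : p ∈ Finset.Icc 1 N) (hq : q ∈ Finset.Icc 1 N)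
    (hk : k ∈ Finset.Icc 1 N) (hj : j ∈ Finset.Icc 1 N) :
    ⁅Em N p q, Ep N k j⁆ =
      (if q = k then Ep N p j else 0) + (if q = j then Ep N k p else 0) := by
  rw [Finset.mem_Icc] at hp hq hk hj
  have hne : ∀ x, x ≤ N → ∀ y, 1 ≤ y → N + y ≠ x := by omega
  simp (disch := omega) only [Ring.lie_def, Em, Ep, sub_mul, mul_sub, add_mul, mul_add, eM_mul,
    Nat.add_left_cancel_iff]
  simp (disch := omega) only [hne, if_false]
  simp only [eq_comm (a := j), eq_comm (a := k)]
  split_ifs <;> abel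

theorem lie_Ep_Ep {p q k j : ℕ} (hp : p ∈ Finset.Icc 1 N) (hq : q ∈ Finset.Icc 1 N)
    (hk : k ∈ Finset.Icc 1 N) (hj : j ∈ Finset.Icc 1 N) :
    ⁅Ep N p q, Ep N k j⁆ = 0 := by
  rw [Finset.mem_Icc] at hp hq hk hj
  have hne : ∀ x, x ≤ N → ∀ y, 1 ≤ y → N + y ≠ x := by omega
  simp (disch := omega) only [Ring.lie_def, Ep, add_mul, mul_add, eM_mul]
  simp (disch := omega) only [hne, if_false]
  abel

theorem lie_Ep_Em {p q k j : ℕ} (hp : p ∈ Finset.Icc 1 N) (hq : q ∈ Finset.Icc 1 N)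
    (hk : k ∈ Finset.Icc 1 N) (hj : j ∈ Finset.Icc 1 N) :
    ⁅Ep N p q, Em N k j⁆ =
      -((if j = p then Ep N k q else 0) + (if j = q then Ep N p k else 0)) := by
  rw [← neg_commutator, lie_Em_Ep hk hj hp hq]

/-- The `k`-th link of the chain. -/
noncomputable def chainLink (N : ℕ) (κ : ℂ) (k : ℕ) :
    Matrix (Fin (2*N)) (Fin (2*N)) ℂ ⊗[ℂ] Matrix (Fin (2*N)) (Fin (2*N)) ℂ :=
  wedge (Hgen N k) (Ep N k k) + κ • ∑ i ∈ Finset.Icc (k+1) N, wedge (Em N k i) (Ep N k i)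

theorem adTensor_Em_chainLink (κ : ℂ) {k p q : ℕ} (hk : 1 ≤ k) (hkp : k < p) (hkq : k < q)
    (hp : p ≤ N) (hq : q ≤ N) : adTensor (Em N p q) (chainLink N κ k) = 0 := by
  have mp : p ∈ Finset.Icc 1 N := Finset.mem_Icc.2 (by omega)
  have mq : q ∈ Finset.Icc 1 N := Finset.mem_Icc.2 (by omega)
  have mk : k ∈ Finset.Icc 1 N := Finset.mem_Icc.2 (by omega)
  have hsum : ∑ i ∈ Finset.Icc (k+1) N, adTensor (Em N p q) (wedge (Em N k i) (Ep N k i)) =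
      ∑ i ∈ Finset.Icc (k+1) N, ((if p = i then -wedge (Em N k q) (Ep N k p) else 0) +
        (if q = i then wedge (Em N k q) (Ep N k p) else 0)) := by
    refine Finset.sum_congr rfl fun i hi => ?_
    rw [Finset.mem_Icc] at hi
    have mi : i ∈ Finset.Icc 1 N := Finset.mem_Icc.2 (by omega)
    rw [adTensor_wedge, lie_Em_Em mp mq mk mi, lie_Em_Ep mp mq mk mi]
    simp only [if_neg hkq.ne', eq_comm (a := i)]
    congr 1 <;> split_ifs with h <;> simp [wedge, h, neg_tmul, tmul_neg]
    abel
  rw [chainLink, map_add, map_smul, map_sum, hsum, Finset.sum_add_distrib, Finset.sum_ite_eq,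
    Finset.sum_ite_eq, if_pos (Finset.mem_Icc.2 ⟨hkp, hp⟩), if_pos (Finset.mem_Icc.2 ⟨hkq, hq⟩),
    neg_add_cancel, smul_zero, add_zero, adTensor_wedge, Hgen_eq_smul_Em, commutator_smul,
    lie_Em_Em mp mq mk mk, lie_Em_Ep mp mq mk mk]
  simp [wedge, hkq.ne', hkp.ne]

theorem adTensor_Ep_chainLink (κ : ℂ) {k p q : ℕ} (hk : 1 ≤ k) (hkp : k < p) (hkq : k < q)
    (hp : p ≤ N) (hq : q ≤ N) : adTensor (Ep N p q) (chainLink N κ k) = 0 := by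
  have mp : p ∈ Finset.Icc 1 N := Finset.mem_Icc.2 (by omega)
  have mq : q ∈ Finset.Icc 1 N := Finset.mem_Icc.2 (by omega)
  have mk : k ∈ Finset.Icc 1 N := Finset.mem_Icc.2 (by omega)
  have hsum : ∑ i ∈ Finset.Icc (k+1) N, adTensor (Ep N p q) (wedge (Em N k i) (Ep N k i)) =
      ∑ i ∈ Finset.Icc (k+1) N, ((if p = i then wedge (Ep N k p) (Ep N k q) else 0) +
        (if q = i then -wedge (Ep N k p) (Ep N k q) else 0)) := by
    refine Finset.sum_congr rfl fun i hi => ?_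
    rw [Finset.mem_Icc] at hi
    have mi : i ∈ Finset.Icc 1 N := Finset.mem_Icc.2 (by omega)
    rw [adTensor_wedge, lie_Ep_Em mp mq mk mi, lie_Ep_Ep mp mq mk mi, Ep_comm p k]
    simp only [eq_comm (a := i)]
    by_cases h : p = i <;> by_cases h' : q = i <;>
      simp [wedge, h, h', neg_tmul, tmul_neg, add_tmul, tmul_add]
    all_goals abel
  rw [chainLink, map_add, map_smul, map_sum, hsum, Finset.sum_add_distrib, Finset.sum_ite_eq,
    Finset.sum_ite_eq, if_pos (Finset.mem_Icc.2 ⟨hkp, hp⟩), if_pos (Finset.mem_Icc.2 ⟨hkq, hq⟩),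
    add_neg_cancel, smul_zero, add_zero, adTensor_wedge, Hgen_eq_smul_Em, commutator_smul,
    lie_Ep_Em mp mq mk mk, lie_Ep_Ep mp mq mk mk, if_neg hkp.ne, if_neg hkq.ne]
  simp [wedge]

theorem cybeForm_chainLink_of_lt (κ κ' : ℂ) {k l : ℕ} (hk : 1 ≤ k) (hkl : k < l) (hl : l ≤ N) :
    cybeForm (chainLink N κ k) (chainLink N κ' l) +
      cybeForm (chainLink N κ' l) (chainLink N κ k) = 0 := by
  set s := chainLink N κ k with hs
  have hH : adTensor (Hgen N l) s = 0 := by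
    rw [Hgen_eq_smul_Em, adTensor_smul_left, adTensor_Em_chainLink κ hk hkl hkl hl hl, smul_zero]
  have h0 := cybeForm_wedge_eq_zero hH (adTensor_Ep_chainLink κ hk hkl hkl hl hl)
  have hi : ∑ i ∈ Finset.Icc (l+1) N, (cybeForm s (wedge (Em N l i) (Ep N l i)) +
      cybeForm (wedge (Em N l i) (Ep N l i)) s) = 0 := by
    refine Finset.sum_eq_zero fun i hi => ?_
    rw [Finset.mem_Icc] at hi
    exact cybeForm_wedge_eq_zero (adTensor_Em_chainLink κ hk hkl (by omega) hl hi.2)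
      (adTensor_Ep_chainLink κ hk hkl (by omega) hl hi.2)
  rw [Finset.sum_add_distrib] at hi
  simp only [chainLink, map_add, map_smul, map_sum, LinearMap.add_apply, LinearMap.smul_apply,
    LinearMap.sum_apply]
  rw [add_add_add_comm, h0, ← smul_add, hi, smul_zero, add_zero]

theorem cybeForm_chainLink_self {κ : ℂ} (hκ : κ = 0 ∨ κ = 1) {k : ℕ} (hk : k ∈ Finset.Icc 1 N) :
    cybeForm (chainLink N κ k) (chainLink N κ k) = 0 := by
  have hS : ∀ i ∈ Finset.Icc (k+1) N, i ∈ Finset.Icc 1 N ∧ i ≠ k := by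
    intro i hi
    rw [Finset.mem_Icc] at hi ⊢
    omega
  apply cybeForm_extended_jordanian _ hκ
  · rw [Hgen_eq_smul_Em, smul_commutator, lie_Em_Ep hk hk hk hk, if_pos rfl]
    module
  · intro i hi
    obtain ⟨mi, hik⟩ := hS i hi
    rw [Hgen_eq_smul_Em, smul_commutator, lie_Em_Em hk hk hk mi, if_pos rfl, if_neg hik, sub_zero]
  · intro i hi
    obtain ⟨mi, hik⟩ := hS i hi
    rw [Hgen_eq_smul_Em, smul_commutator, lie_Em_Ep hk hk hk mi, if_pos rfl, if_neg hik.symm, add_zero]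
  · intro i hi
    obtain ⟨mi, hik⟩ := hS i hi
    rw [lie_Ep_Em hk hk hk mi, if_neg hik, add_zero, neg_zero]
  · intro i hi
    exact lie_Ep_Ep hk hk hk (hS i hi).1
  · intro i hi j hj
    rw [lie_Em_Em hk (hS i hi).1 hk (hS j hj).1, if_neg (hS i hi).2, if_neg (hS j hj).2, sub_zero]
  · intro i hi j hj
    exact lie_Ep_Ep hk (hS i hi).1 hk (hS j hj).1
  · intro i hi
    rw [lie_Em_Ep hk (hS i hi).1 hk (hS i hi).1, if_neg (hS i hi).2, if_pos rfl, zero_add]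
  · intro i hi j hj hij
    rw [lie_Em_Ep hk (hS i hi).1 hk (hS j hj).1, if_neg (hS i hi).2, if_neg hij, zero_add]

end Symplectic

/-- the multiparametric chain classical r-matrix
`r = Σ_{k=1}^{N} η_k (H_{kk} ∧ E_{k+k} + κ_k Σ_{i=k+1}^{N} E_{k−i} ∧ E_{k+i})`,
with `η_k ∈ ℂ` and `κ_k ∈ {0,1}`, satisfies the classical Yang–Baxter equation. -/
theorem chain_r_matrix_CYBE (N : ℕ) (hN : 1 ≤ N) (η κ : ℕ → ℂ)
    (hκ : ∀ k ∈ Finset.Icc 1 N, κ k = 0 ∨ κ k = 1) :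
    CYBE (Matrix (Fin (2*N)) (Fin (2*N)) ℂ)
      (∑ k ∈ Finset.Icc 1 N, η k •
        (wedge (Hgen N k) (Ep N k k) +
          κ k • ∑ i ∈ Finset.Icc (k+1) N, wedge (Em N k i) (Ep N k i))) := by
  refine (cybe_iff_cybeForm _).2 (cybeForm_sum_self _ (fun k => η k • chainLink N (κ k) k) ?_)
  intro k hk l hl
  have hform : cybeForm (chainLink N (κ k) k) (chainLink N (κ l) l) +
      cybeForm (chainLink N (κ l) l) (chainLink N (κ k) k) = 0 := by
    have hk' := Finset.mem_Icc.1 hk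
    have hl' := Finset.mem_Icc.1 hl
    rcases lt_trichotomy k l with h | rfl | h
    · exact cybeForm_chainLink_of_lt _ _ hk'.1 h hl'.2
    · rw [cybeForm_chainLink_self (hκ k hk) hk, add_zero]
    · rw [add_comm]
      exact cybeForm_chainLink_of_lt _ _ hl'.1 h hk'.2
  simp only [map_smul, LinearMap.smul_apply]
  rw [smul_comm (η l), ← smul_add, ← smul_add, hform, smul_zero, smul_zero]
end
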